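/- arXiv:0801.3865 — 10 statements merged into one kernel-verified Lean document; each statement's English description precedes it below -/
import Mathlib

section
/- Let A be an n×n real matrix that is positive definite in the sense that xᵀAx > 0 for every nonzero x ∈ ℝⁿ. Then its symmetric part A_s = (A + Aᵀ)/2 is symmetric positive definite (hence invertible), and the matrix Ã = Aᵀ A_s⁻¹ A is symmetric positive definite. -/
open scoped Matrix

/-- A matrix with positive quadratic form has a trivial kernel. -/
theorem mulVec_injective_of_dotProduct_mulVec_pos {ι : Type*} [Fintype ι] {A : Matrix ι ι ℝ}
    (hA : ∀ x : ι → ℝ, x ≠ 0 → 0 < x ⬝ᵥ (A *ᵥ x)) : Function.Injective A.mulVec := by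
  intro x y hxy
  by_contra hne
  have h := hA (x - y) (sub_ne_zero.mpr hne)
  rw [Matrix.mulVec_sub, sub_eq_zero.mpr hxy, dotProduct_zero] at h
  exact h.false

/-- The symmetric part of a matrix with positive quadratic form is positive definite. -/
theorem posDef_symmetricPart {ι : Type*} [Fintype ι] {A : Matrix ι ι ℝ}
    (hA : ∀ x : ι → ℝ, x ≠ 0 → 0 < x ⬝ᵥ (A *ᵥ x)) :
    ((1 / 2 : ℝ) • (A + Aᵀ)).PosDef := by
  refine Matrix.PosDef.of_dotProduct_mulVec_pos ?_ fun x hx => ?_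
  · simp [Matrix.IsHermitian, Matrix.conjTranspose_eq_transpose_of_trivial, add_comm]
  · have htranspose : x ⬝ᵥ (Aᵀ *ᵥ x) = x ⬝ᵥ (A *ᵥ x) := by
      rw [Matrix.mulVec_transpose, dotProduct_comm, Matrix.dotProduct_mulVec]
    rw [star_trivial, Matrix.smul_mulVec, Matrix.add_mulVec, dotProduct_smul, dotProduct_add,
      htranspose, smul_eq_mul]
    linarith [hA x hx]

/-- If `A` is positive definite in the sense that `xᵀ A x > 0` for all `x ≠ 0`, then its
symmetric part `As = (A + Aᵀ)/2` is symmetric positive definite (hence invertible), and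
`Ã = Aᵀ As⁻¹ A` is symmetric positive definite. -/
theorem symmetric_part_and_tildeA_posDef {n : ℕ} (A As : Matrix (Fin n) (Fin n) ℝ)
    (hA : ∀ x : Fin n → ℝ, x ≠ 0 → 0 < x ⬝ᵥ (A *ᵥ x))
    (hAs : As = (1 / 2 : ℝ) • (A + Aᵀ)) :
    As.PosDef ∧ IsUnit As ∧ (Aᵀ * As⁻¹ * A).PosDef := by
  have hpos : As.PosDef := hAs ▸ posDef_symmetricPart hA
  refine ⟨hpos, hpos.isUnit, ?_⟩
  rw [← Matrix.conjTranspose_eq_transpose_of_trivial]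
  exact hpos.inv.conjTranspose_mul_mul_same (mulVec_injective_of_dotProduct_mulVec_pos hA)
end

section
/- Let A be an n×n real matrix satisfying ⟨Ax, x⟩ ≥ δ|x|² for all x ∈ ℝⁿ and some δ > 0, with symmetric part A_s = (A + Aᵀ)/2 and anti-symmetric part A_a = (A − Aᵀ)/2, and let b ∈ ℝⁿ. Then the functional I(x) = ½⟨Ax, x⟩ + ½⟨A_s⁻¹(b − A_a x), b − A_a x⟩ − ⟨b, x⟩ satisfies I(x) ≥ 0 for every x ∈ ℝⁿ. -/
open scoped Matrix

/-- Fenchel–Young inequality for the quadratic form of a positive definite real matrix. -/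
theorem Matrix.PosDef.two_mul_dotProduct_le {ι : Type*} [Fintype ι] [DecidableEq ι]
    {S : Matrix ι ι ℝ} (hS : S.PosDef) (p x : ι → ℝ) :
    2 * (p ⬝ᵥ x) ≤ (S *ᵥ x) ⬝ᵥ x + (S⁻¹ *ᵥ p) ⬝ᵥ p := by
  have hp : S *ᵥ (S⁻¹ *ᵥ p) = p := by
    rw [Matrix.mulVec_mulVec, Matrix.mul_nonsing_inv S (S.isUnit_iff_isUnit_det.mp hS.isUnit),
      Matrix.one_mulVec]
  have hST : Sᵀ = S := by simpa using hS.isHermitian.eq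
  set y := S⁻¹ *ᵥ p
  have hxy : y ⬝ᵥ (S *ᵥ x) = p ⬝ᵥ x := by
    rw [Matrix.dotProduct_mulVec, ← Matrix.mulVec_transpose, hST, hp]
  have h : 0 ≤ (x - y) ⬝ᵥ (S *ᵥ (x - y)) := by
    simpa using hS.posSemidef.dotProduct_mulVec_nonneg (x - y)
  simp only [Matrix.mulVec_sub, dotProduct_sub, sub_dotProduct, hp, hxy] at h
  rw [dotProduct_comm (S *ᵥ x) x]
  linarith [dotProduct_comm x p]

/-- The quadratic form of the transpose of a matrix is that of the matrix itself. -/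
theorem Matrix.transpose_mulVec_dotProduct_self {ι R : Type*} [Fintype ι] [CommSemiring R]
    (A : Matrix ι ι R) (x : ι → R) : (Aᵀ *ᵥ x) ⬝ᵥ x = (A *ᵥ x) ⬝ᵥ x := by
  rw [Matrix.mulVec_transpose, ← Matrix.dotProduct_mulVec, dotProduct_comm]

/-- If `⟨Ax, x⟩ ≥ δ|x|²` for all `x` and some `δ > 0`, then the selfdual functional
`I(x) = ½⟨Ax, x⟩ + ½⟨As⁻¹(b − Aa x), b − Aa x⟩ − ⟨b, x⟩` is nonnegative on `ℝⁿ`. -/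
theorem selfdual_functional_nonneg {n : ℕ} (A As Aa : Matrix (Fin n) (Fin n) ℝ)
    (hAs : As = (1 / 2 : ℝ) • (A + Aᵀ)) (hAa : Aa = (1 / 2 : ℝ) • (A - Aᵀ))
    (δ : ℝ) (hδ : 0 < δ)
    (hcoer : ∀ x : Fin n → ℝ, δ * (x ⬝ᵥ x) ≤ (A *ᵥ x) ⬝ᵥ x)
    (b : Fin n → ℝ) (I : (Fin n → ℝ) → ℝ)
    (hI : ∀ x : Fin n → ℝ,
      I x = (1 / 2 : ℝ) * ((A *ᵥ x) ⬝ᵥ x)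
        + (1 / 2 : ℝ) * ((As⁻¹ *ᵥ (b - Aa *ᵥ x)) ⬝ᵥ (b - Aa *ᵥ x)) - b ⬝ᵥ x) :
    ∀ x : Fin n → ℝ, 0 ≤ I x := by
  intro x
  have hquad (y : Fin n → ℝ) : (As *ᵥ y) ⬝ᵥ y = (A *ᵥ y) ⬝ᵥ y := by
    rw [hAs, Matrix.smul_mulVec, Matrix.add_mulVec, smul_dotProduct, add_dotProduct,
      A.transpose_mulVec_dotProduct_self, smul_eq_mul]
    ring
  have hskew : (Aa *ᵥ x) ⬝ᵥ x = 0 := by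
    rw [hAa, Matrix.smul_mulVec, Matrix.sub_mulVec, smul_dotProduct, sub_dotProduct,
      A.transpose_mulVec_dotProduct_self, sub_self, smul_zero]
  have hpos : As.PosDef := by
    refine .of_dotProduct_mulVec_pos ?_ fun y hy => ?_
    · simp [Matrix.IsHermitian, hAs, add_comm]
    · have hyy : 0 < y ⬝ᵥ y := by simpa using Matrix.dotProduct_star_self_pos_iff.mpr hy
      rw [star_trivial, dotProduct_comm, hquad]
      exact (mul_pos hδ hyy).trans_le (hcoer y)
  have h := hpos.two_mul_dotProduct_le (b - Aa *ᵥ x) x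
  rw [sub_dotProduct b, hskew, hquad] at h
  rw [hI]
  linarith
end

section
/- Let A be an n×n real matrix satisfying ⟨Ax, x⟩ ≥ δ|x|² for all x ∈ ℝⁿ and some δ > 0, with symmetric part A_s = (A + Aᵀ)/2 and anti-symmetric part A_a = (A − Aᵀ)/2, and let b ∈ ℝⁿ. Set I(x) = ½⟨Ax, x⟩ + ½⟨A_s⁻¹(b − A_a x), b − A_a x⟩ − ⟨b, x⟩. Then for x ∈ ℝⁿ one has I(x) = 0 if and only if Ax = b; in particular, the (unique) solution x̄ of Ax = b attains the infimum of I over ℝⁿ and I(x̄) = 0. -/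
open scoped Matrix

namespace Matrix

variable {ι : Type*} [Fintype ι]

theorem transpose_mulVec_dotProduct_self_s5 (A : Matrix ι ι ℝ) (x : ι → ℝ) :
    (Aᵀ *ᵥ x) ⬝ᵥ x = (A *ᵥ x) ⬝ᵥ x := by
  rw [mulVec_transpose, ← dotProduct_mulVec, dotProduct_comm]

theorem symmPart_mulVec_dotProduct_self (A : Matrix ι ι ℝ) (x : ι → ℝ) :
    (((1 / 2 : ℝ) • (A + Aᵀ)) *ᵥ x) ⬝ᵥ x = (A *ᵥ x) ⬝ᵥ x := by
  rw [smul_mulVec, add_mulVec, smul_dotProduct, add_dotProduct,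
    transpose_mulVec_dotProduct_self_s5, smul_eq_mul]
  ring

theorem antisymmPart_mulVec_dotProduct_self (A : Matrix ι ι ℝ) (x : ι → ℝ) :
    (((1 / 2 : ℝ) • (A - Aᵀ)) *ᵥ x) ⬝ᵥ x = 0 := by
  rw [smul_mulVec, sub_mulVec, smul_dotProduct, sub_dotProduct,
    transpose_mulVec_dotProduct_self_s5, sub_self, smul_zero]

theorem isUnit_of_coercive [DecidableEq ι] {M : Matrix ι ι ℝ} {δ : ℝ} (hδ : 0 < δ)
    (hM : ∀ x : ι → ℝ, δ * (x ⬝ᵥ x) ≤ (M *ᵥ x) ⬝ᵥ x) : IsUnit M := by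
  rw [← mulVec_injective_iff_isUnit]
  intro x y hxy
  have h := hM (x - y)
  rw [mulVec_sub, sub_eq_zero.mpr hxy, zero_dotProduct] at h
  have h_nonneg : 0 ≤ (x - y) ⬝ᵥ (x - y) := Finset.sum_nonneg fun i _ => mul_self_nonneg _
  exact sub_eq_zero.mp (dotProduct_self_eq_zero.mp (by nlinarith))

theorem IsSymm.mulVec_sub_dotProduct_sub {S : Matrix ι ι ℝ} (hS : S.IsSymm) (u x : ι → ℝ) :
    (S *ᵥ (u - x)) ⬝ᵥ (u - x)
      = u ⬝ᵥ (S *ᵥ u) - 2 * ((S *ᵥ u) ⬝ᵥ x) + (S *ᵥ x) ⬝ᵥ x := by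
  have h : (S *ᵥ x) ⬝ᵥ u = (S *ᵥ u) ⬝ᵥ x := by
    rw [dotProduct_comm, dotProduct_mulVec, ← mulVec_transpose, hS.eq]
  rw [mulVec_sub, sub_dotProduct, dotProduct_sub, dotProduct_sub, h, dotProduct_comm (S *ᵥ u) u]
  ring

end Matrix

/-- Under the coercivity assumption `⟨Ax, x⟩ ≥ δ|x|²` (`δ > 0`), the selfdual functional
`I(x) = ½⟨Ax, x⟩ + ½⟨As⁻¹(b − Aa x), b − Aa x⟩ − ⟨b, x⟩` vanishes at `x` iff `A x = b`;
in particular there is a unique solution `x̄` of `A x = b`, and it attains the infimum of `I`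
with `I(x̄) = 0`. -/
theorem selfdual_variational_principle {n : ℕ} (A As Aa : Matrix (Fin n) (Fin n) ℝ)
    (hAs : As = (1 / 2 : ℝ) • (A + Aᵀ)) (hAa : Aa = (1 / 2 : ℝ) • (A - Aᵀ))
    (δ : ℝ) (hδ : 0 < δ)
    (hcoer : ∀ x : Fin n → ℝ, δ * (x ⬝ᵥ x) ≤ (A *ᵥ x) ⬝ᵥ x)
    (b : Fin n → ℝ) (I : (Fin n → ℝ) → ℝ)
    (hI : ∀ x : Fin n → ℝ,
      I x = (1 / 2 : ℝ) * ((A *ᵥ x) ⬝ᵥ x)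
        + (1 / 2 : ℝ) * ((As⁻¹ *ᵥ (b - Aa *ᵥ x)) ⬝ᵥ (b - Aa *ᵥ x)) - b ⬝ᵥ x) :
    (∀ x : Fin n → ℝ, I x = 0 ↔ A *ᵥ x = b) ∧
      (∃! xbar : Fin n → ℝ, A *ᵥ xbar = b) ∧
      (∀ xbar : Fin n → ℝ, A *ᵥ xbar = b → I xbar = 0 ∧ ∀ y : Fin n → ℝ, I xbar ≤ I y) := by
  have hsum : As + Aa = A := by
    rw [hAs, hAa]
    module
  have hsymm : As.IsSymm := by
    rw [hAs]
    exact (Matrix.isSymm_add_transpose_self A).smul _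
  have hquad (x : Fin n → ℝ) : (As *ᵥ x) ⬝ᵥ x = (A *ᵥ x) ⬝ᵥ x := by
    rw [hAs, Matrix.symmPart_mulVec_dotProduct_self]
  have hanti (x : Fin n → ℝ) : (Aa *ᵥ x) ⬝ᵥ x = 0 := by
    rw [hAa, Matrix.antisymmPart_mulVec_dotProduct_self]
  have hA_unit : IsUnit A := Matrix.isUnit_of_coercive hδ hcoer
  have hAs_unit : IsUnit As :=
    Matrix.isUnit_of_coercive hδ fun x => (hcoer x).trans (hquad x).ge
  have hcancel (v : Fin n → ℝ) : As *ᵥ (As⁻¹ *ᵥ v) = v := by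
    rw [Matrix.mulVec_mulVec,
      Matrix.mul_nonsing_inv _ ((Matrix.isUnit_iff_isUnit_det _).mp hAs_unit), Matrix.one_mulVec]
  -- Completing the square: `I x` is half the quadratic form of `A` at `As⁻¹ (b - A x)`.
  have hsquare (x : Fin n → ℝ) :
      I x = (1 / 2 : ℝ) * ((A *ᵥ (As⁻¹ *ᵥ (b - Aa *ᵥ x) - x)) ⬝ᵥ
        (As⁻¹ *ᵥ (b - Aa *ᵥ x) - x)) := by
    rw [hI, ← hquad (_ - x), hsymm.mulVec_sub_dotProduct_sub, hcancel, hquad,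
      sub_dotProduct _ _ x, hanti]
    ring
  have hself_nonneg (x : Fin n → ℝ) : 0 ≤ x ⬝ᵥ x :=
    Finset.sum_nonneg fun i _ => mul_self_nonneg _
  have hI_nonneg (x : Fin n → ℝ) : 0 ≤ I x := by
    rw [hsquare]
    exact mul_nonneg (by norm_num) ((mul_nonneg hδ.le (hself_nonneg _)).trans (hcoer _))
  have hiff (x : Fin n → ℝ) : I x = 0 ↔ A *ᵥ x = b := by
    have hsolve : A *ᵥ x = b ↔ As⁻¹ *ᵥ (b - Aa *ᵥ x) - x = 0 := by
      rw [← (Matrix.mulVec_injective_iff_isUnit.mpr hAs_unit).eq_iff (a := _ - x),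
        Matrix.mulVec_sub As, hcancel,
        Matrix.mulVec_zero, sub_sub, ← Matrix.add_mulVec, add_comm Aa, hsum, sub_eq_zero, eq_comm]
    rw [hsolve, hsquare]
    constructor
    · intro h
      have hc := hcoer (As⁻¹ *ᵥ (b - Aa *ᵥ x) - x)
      have hn := hself_nonneg (As⁻¹ *ᵥ (b - Aa *ᵥ x) - x)
      exact dotProduct_self_eq_zero.mp (by nlinarith)
    · intro h
      rw [h, dotProduct_zero, mul_zero]
  refine ⟨hiff, ?_, fun x hx => ?_⟩
  · exact Function.Bijective.existsUnique ⟨Matrix.mulVec_injective_iff_isUnit.mpr hA_unit,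
      Matrix.mulVec_surjective_iff_isUnit.mpr hA_unit⟩ b
  · have hx_zero := (hiff x).mpr hx
    exact ⟨hx_zero, fun y => hx_zero.trans_le (hI_nonneg y)⟩
end

section
/- Let A be an n×n real matrix satisfying ⟨Ax, x⟩ ≥ δ|x|² for all x ∈ ℝⁿ and some δ > 0, with symmetric part A_s = (A + Aᵀ)/2 and anti-symmetric part A_a = (A − Aᵀ)/2, and let b ∈ ℝⁿ. Then the functional I(x) = ½⟨Ax, x⟩ + ½⟨A_s⁻¹(b − A_a x), b − A_a x⟩ − ⟨b, x⟩ is a convex function on ℝⁿ. -/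
open scoped Matrix

namespace Matrix

variable {m : Type*} [Fintype m]

/-- The quadratic form of a (not necessarily symmetric) matrix is convex when it is nonnegative. -/
theorem convexOn_mulVec_dotProduct_self {M : Matrix m m ℝ}
    (hM : ∀ x, 0 ≤ (M *ᵥ x) ⬝ᵥ x) : ConvexOn ℝ Set.univ fun x => (M *ᵥ x) ⬝ᵥ x := by
  refine ⟨convex_univ, fun x _ y _ a b ha hb hab => ?_⟩
  have h := mul_nonneg (mul_nonneg ha hb) (hM (x - y))
  obtain rfl : b = 1 - a := by linarith
  simp only [mulVec_sub, mulVec_add, mulVec_smul, sub_dotProduct, dotProduct_sub, add_dotProduct,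
    dotProduct_add, smul_dotProduct, dotProduct_smul, smul_eq_mul] at h ⊢
  linarith

theorem dotProduct_transpose_mulVec_self (M : Matrix m m ℝ) (x : m → ℝ) :
    x ⬝ᵥ (Mᵀ *ᵥ x) = x ⬝ᵥ (M *ᵥ x) := by
  rw [mulVec_transpose, dotProduct_comm, dotProduct_mulVec]

theorem posSemidef_symmetricPart {M : Matrix m m ℝ} (hM : ∀ x, 0 ≤ (M *ᵥ x) ⬝ᵥ x) :
    ((1 / 2 : ℝ) • (M + Mᵀ)).PosSemidef := by
  refine .of_dotProduct_mulVec_nonneg ?_ fun x => ?_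
  · simp [IsHermitian, conjTranspose_eq_transpose_of_trivial, add_comm]
  · have h := hM x
    rw [dotProduct_comm] at h
    simp only [star_trivial, smul_mulVec, add_mulVec, dotProduct_smul, dotProduct_add,
      dotProduct_transpose_mulVec_self, smul_eq_mul]
    linarith

end Matrix



/-- Under the coercivity assumption `⟨Ax, x⟩ ≥ δ|x|²` (`δ > 0`), the selfdual functional
`I(x) = ½⟨Ax, x⟩ + ½⟨As⁻¹(b − Aa x), b − Aa x⟩ − ⟨b, x⟩` is convex on `ℝⁿ`. -/
theorem selfdual_functional_convex {n : ℕ} (A As Aa : Matrix (Fin n) (Fin n) ℝ)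
    (hAs : As = (1 / 2 : ℝ) • (A + Aᵀ)) (hAa : Aa = (1 / 2 : ℝ) • (A - Aᵀ))
    (δ : ℝ) (hδ : 0 < δ)
    (hcoer : ∀ x : Fin n → ℝ, δ * (x ⬝ᵥ x) ≤ (A *ᵥ x) ⬝ᵥ x)
    (b : Fin n → ℝ) (I : (Fin n → ℝ) → ℝ)
    (hI : ∀ x : Fin n → ℝ,
      I x = (1 / 2 : ℝ) * ((A *ᵥ x) ⬝ᵥ x)
        + (1 / 2 : ℝ) * ((As⁻¹ *ᵥ (b - Aa *ᵥ x)) ⬝ᵥ (b - Aa *ᵥ x)) - b ⬝ᵥ x) :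
    ConvexOn ℝ Set.univ I := by
  have hA (x : Fin n → ℝ) : 0 ≤ (A *ᵥ x) ⬝ᵥ x :=
    (mul_nonneg hδ.le (by simpa using dotProduct_star_self_nonneg x)).trans (hcoer x)
  have hAs' : As⁻¹.PosSemidef := (hAs ▸ Matrix.posSemidef_symmetricPart hA).inv
  have hquad := (Matrix.convexOn_mulVec_dotProduct_self hA).smul (c := 1 / 2) (by norm_num)
  have hdual := ((Matrix.convexOn_mulVec_dotProduct_self (M := As⁻¹) fun x => by
    simpa [dotProduct_comm] using hAs'.dotProduct_mulVec_nonneg x).comp_affineMap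
      (AffineMap.const ℝ (Fin n → ℝ) b - Aa.mulVecLin.toAffineMap)).smul
      (c := 1 / 2) (by norm_num)
  have hlin : ConcaveOn ℝ Set.univ fun x : Fin n → ℝ => b ⬝ᵥ x :=
    (dotProductBilin ℝ ℝ b).concaveOn convex_univ
  rw [funext hI]
  exact (hquad.add hdual).sub hlin
end

section
/- Let A be an n×n real matrix that is positive definite (xᵀAx > 0 for all x ≠ 0), with symmetric part A_s = (A + Aᵀ)/2 and anti-symmetric part A_a = (A − Aᵀ)/2, and set Ã = A_s − A_a A_s⁻¹ A_a. Then the smallest eigenvalue of the symmetric matrix Ã satisfies λ_min(Ã) ≥ λ_min(A_s). -/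
open scoped Matrix

/-- The Rayleigh quotient of a real symmetric matrix is bounded below by any lower bound of its
eigenvalues. -/
theorem Matrix.IsHermitian.mul_dotProduct_self_le {ι : Type*} [Fintype ι] [DecidableEq ι]
    {S : Matrix ι ι ℝ} (hS : S.IsHermitian) {c : ℝ} (hc : ∀ i, c ≤ hS.eigenvalues i)
    (x : ι → ℝ) : c * (x ⬝ᵥ x) ≤ x ⬝ᵥ (S *ᵥ x) := by
  have hpsd : (S - algebraMap ℝ (Matrix ι ι ℝ) c).PosSemidef := by
    rw [Matrix.posSemidef_iff_isHermitian_and_spectrum_nonneg]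
    refine ⟨hS.sub ?_, ?_⟩
    · rw [Matrix.algebraMap_eq_diagonal]
      exact Matrix.isHermitian_diagonal _
    · intro μ hμ
      rw [← spectrum.sub_singleton_eq, hS.spectrum_real_eq_range_eigenvalues] at hμ
      obtain ⟨_, ⟨i, rfl⟩, _, rfl, rfl⟩ := hμ
      exact sub_nonneg.mpr (hc i)
  have h := hpsd.dotProduct_mulVec_nonneg x
  rw [Algebra.algebraMap_eq_smul_one, Matrix.sub_mulVec, Matrix.smul_mulVec,
    Matrix.one_mulVec, dotProduct_sub, dotProduct_smul] at h
  simpa using h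

/-- For a positive definite (not necessarily symmetric) matrix `A` with symmetric part `As`
and anti-symmetric part `Aa`, and `Ã = As − Aa As⁻¹ Aa`, the smallest eigenvalue of `Ã`
satisfies `λ_min(Ã) ≥ λ_min(As)`. -/
theorem lambda_min_tildeA_ge {n : ℕ} (hn : 0 < n) (A As Aa At : Matrix (Fin n) (Fin n) ℝ)
    (hA : ∀ x : Fin n → ℝ, x ≠ 0 → 0 < x ⬝ᵥ (A *ᵥ x))
    (hAs : As = (1 / 2 : ℝ) • (A + Aᵀ)) (hAa : Aa = (1 / 2 : ℝ) • (A - Aᵀ))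
    (hAt : At = As - Aa * As⁻¹ * Aa)
    (hAsh : As.IsHermitian) (hAth : At.IsHermitian) :
    (⨅ i, hAsh.eigenvalues i) ≤ ⨅ i, hAth.eigenvalues i := by
  have : Nonempty (Fin n) := ⟨⟨0, hn⟩⟩
  have hpos : As.PosDef := by
    refine Matrix.PosDef.of_dotProduct_mulVec_pos hAsh fun x hx => ?_
    have hT : x ⬝ᵥ (Aᵀ *ᵥ x) = x ⬝ᵥ (A *ᵥ x) := by
      rw [Matrix.mulVec_transpose, dotProduct_comm, Matrix.dotProduct_mulVec]
    have h := hA x hx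
    rw [star_trivial, hAs, Matrix.smul_mulVec, Matrix.add_mulVec, dotProduct_smul,
      dotProduct_add, hT, smul_eq_mul]
    linarith
  have hskew : Aaᵀ = -Aa := by
    rw [hAa, Matrix.transpose_smul, Matrix.transpose_sub, Matrix.transpose_transpose,
      ← smul_neg, neg_sub]
  have hle (x : Fin n → ℝ) : x ⬝ᵥ (As *ᵥ x) ≤ x ⬝ᵥ (At *ᵥ x) := by
    have h := hpos.inv.posSemidef.dotProduct_mulVec_nonneg (Aa *ᵥ x)
    have hx : x ᵥ* Aa = -(Aa *ᵥ x) := by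
      rw [← Matrix.mulVec_transpose, hskew, Matrix.neg_mulVec]
    rw [star_trivial] at h
    rw [hAt, Matrix.sub_mulVec, dotProduct_sub, ← Matrix.mulVec_mulVec, ← Matrix.mulVec_mulVec,
      Matrix.dotProduct_mulVec x Aa, hx, neg_dotProduct]
    linarith
  refine le_ciInf fun i => ?_
  have hunit : (hAth.eigenvectorBasis i).ofLp ⬝ᵥ (hAth.eigenvectorBasis i).ofLp = 1 := by
    have h := real_inner_self_eq_norm_sq (hAth.eigenvectorBasis i)
    rwa [hAth.eigenvectorBasis.orthonormal.1 i, one_pow,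
      EuclideanSpace.inner_eq_star_dotProduct, star_trivial] at h
  have h := (hAsh.mul_dotProduct_self_le
    (fun j => ciInf_le (Set.finite_range hAsh.eigenvalues).bddBelow j) _).trans
    (hle (hAth.eigenvectorBasis i).ofLp)
  rwa [hAth.mulVec_eigenvectorBasis, dotProduct_smul, hunit, smul_eq_mul, mul_one, mul_one] at h
end

section
/- Let A be an n×n real matrix that is positive definite (xᵀAx > 0 for all x ≠ 0), with symmetric part A_s = (A + Aᵀ)/2 and an invertible anti-symmetric part A_a = (A − Aᵀ)/2, and set Ã = A_s − A_a A_s⁻¹ A_a. Then the smallest eigenvalue of Ã satisfies λ_min(Ã) ≥ λ_min(−A_a²)/λ_max(A_s), where −A_a² = A_aᵀA_a is symmetric positive definite. -/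
open scoped Matrix

namespace Matrix

theorem IsHermitian.exists_dotProduct_mulVec_eq_sum {ι : Type*} [Fintype ι] [DecidableEq ι]
    {M : Matrix ι ι ℝ} (hM : M.IsHermitian) (x : ι → ℝ) :
    ∃ c : ι → ℝ, x ⬝ᵥ x = ∑ i, c i ^ 2 ∧
      x ⬝ᵥ (M *ᵥ x) = ∑ i, hM.eigenvalues i * c i ^ 2 := by
  set U : Matrix ι ι ℝ := hM.eigenvectorUnitary.val with hU
  have hUU : U * Uᵀ = 1 := by
    simpa [hU, star_eq_conjTranspose] using Unitary.coe_mul_star_self hM.eigenvectorUnitary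
  have hspec : M = U * diagonal hM.eigenvalues * Uᵀ := by
    conv_lhs => rw [hM.spectral_theorem, Unitary.conjStarAlgAut_apply]
    simp [hU, star_eq_conjTranspose]
  refine ⟨Uᵀ *ᵥ x, ?_, ?_⟩
  · calc x ⬝ᵥ x = x ⬝ᵥ ((U * Uᵀ) *ᵥ x) := by rw [hUU, one_mulVec]
      _ = (Uᵀ *ᵥ x) ⬝ᵥ (Uᵀ *ᵥ x) := by
        rw [← mulVec_mulVec, dotProduct_mulVec, mulVec_transpose]
      _ = _ := by simp only [dotProduct, sq]
  · calc x ⬝ᵥ (M *ᵥ x) = x ⬝ᵥ ((U * diagonal hM.eigenvalues * Uᵀ) *ᵥ x) := by rw [← hspec]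
      _ = (Uᵀ *ᵥ x) ⬝ᵥ (diagonal hM.eigenvalues *ᵥ (Uᵀ *ᵥ x)) := by
        rw [← mulVec_mulVec, ← mulVec_mulVec, dotProduct_mulVec, mulVec_transpose]
      _ = _ := by
        simp only [dotProduct, mulVec_diagonal]
        exact Finset.sum_congr rfl fun i _ => by ring

theorem IsHermitian.iInf_eigenvalues_mul_le {ι : Type*} [Fintype ι] [DecidableEq ι]
    {M : Matrix ι ι ℝ} (hM : M.IsHermitian) (x : ι → ℝ) :
    (⨅ i, hM.eigenvalues i) * (x ⬝ᵥ x) ≤ x ⬝ᵥ (M *ᵥ x) := by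
  obtain ⟨c, hx, hMx⟩ := hM.exists_dotProduct_mulVec_eq_sum x
  rw [hx, hMx, Finset.mul_sum]
  gcongr with i
  exact ciInf_le (Set.finite_range _).bddBelow i

theorem IsHermitian.le_iSup_eigenvalues_mul {ι : Type*} [Fintype ι] [DecidableEq ι]
    {M : Matrix ι ι ℝ} (hM : M.IsHermitian) (x : ι → ℝ) :
    x ⬝ᵥ (M *ᵥ x) ≤ (⨆ i, hM.eigenvalues i) * (x ⬝ᵥ x) := by
  obtain ⟨c, hx, hMx⟩ := hM.exists_dotProduct_mulVec_eq_sum x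
  rw [hx, hMx, Finset.mul_sum]
  gcongr with i
  exact le_ciSup (Set.finite_range _).bddAbove i

/-- A uniform lower bound on the Rayleigh quotient bounds the smallest eigenvalue. -/
theorem IsHermitian.le_iInf_eigenvalues {ι : Type*} [Fintype ι] [DecidableEq ι] [Nonempty ι]
    {M : Matrix ι ι ℝ} (hM : M.IsHermitian) {a : ℝ}
    (h : ∀ x : ι → ℝ, a * (x ⬝ᵥ x) ≤ x ⬝ᵥ (M *ᵥ x)) : a ≤ ⨅ i, hM.eigenvalues i := by
  refine le_ciInf fun i => ?_
  have hv : (hM.eigenvectorBasis i : ι → ℝ) ≠ 0 := fun h0 =>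
    hM.eigenvectorBasis.orthonormal.ne_zero i (by ext j; exact congrFun h0 j)
  have hi := h (hM.eigenvectorBasis i)
  rw [hM.mulVec_eigenvectorBasis, dotProduct_smul, smul_eq_mul] at hi
  exact le_of_mul_le_mul_right hi (by simpa using dotProduct_star_self_pos_iff.2 hv)

theorem PosDef.iSup_eigenvalues_pos {ι : Type*} [Fintype ι] [DecidableEq ι] [Nonempty ι]
    {M : Matrix ι ι ℝ} (hM : M.PosDef) : 0 < ⨆ i, hM.isHermitian.eigenvalues i :=
  (hM.eigenvalues_pos (Classical.arbitrary ι)).trans_le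
    (le_ciSup (Set.finite_range _).bddAbove _)

theorem PosDef.dotProduct_div_le_inv {ι : Type*} [Fintype ι] [DecidableEq ι] [Nonempty ι]
    {M : Matrix ι ι ℝ} (hM : M.PosDef) (y : ι → ℝ) :
    (y ⬝ᵥ y) / (⨆ i, hM.isHermitian.eigenvalues i) ≤ y ⬝ᵥ (M⁻¹ *ᵥ y) := by
  set L := ⨆ i, hM.isHermitian.eigenvalues i
  have hL : 0 < L := hM.iSup_eigenvalues_pos
  set z := M⁻¹ *ᵥ y
  have hMz : M *ᵥ z = y := by
    simp [z, mulVec_mulVec, mul_nonsing_inv M ((isUnit_iff_isUnit_det M).1 hM.isUnit)]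
  have hzMy : z ⬝ᵥ (M *ᵥ y) = y ⬝ᵥ y := by
    have hMt : Mᵀ = M := hM.isHermitian
    rw [dotProduct_mulVec, ← mulVec_transpose, hMt, hMz]
  have hy : y ⬝ᵥ (M *ᵥ y) ≤ L * (y ⬝ᵥ y) := hM.isHermitian.le_iSup_eigenvalues_mul y
  have hnonneg := hM.posSemidef.dotProduct_mulVec_nonneg (y - L • z)
  simp only [star_trivial, mulVec_sub, mulVec_smul, hMz, sub_dotProduct, dotProduct_sub,
    smul_dotProduct, dotProduct_smul, smul_eq_mul, hzMy, dotProduct_comm z y] at hnonneg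
  rw [div_le_iff₀ hL]
  refine le_of_mul_le_mul_left ?_ hL
  linarith

end Matrix

/-- For a positive definite matrix `A` with symmetric part `As` and invertible anti-symmetric
part `Aa`, and `Ã = As − Aa As⁻¹ Aa`, one has `−Aa² = Aaᵀ Aa` symmetric positive definite and
`λ_min(Ã) ≥ λ_min(−Aa²) / λ_max(As)`. -/
theorem lambda_min_tildeA_ge_antisym {n : ℕ} (hn : 0 < n)
    (A As Aa At : Matrix (Fin n) (Fin n) ℝ)
    (hA : ∀ x : Fin n → ℝ, x ≠ 0 → 0 < x ⬝ᵥ (A *ᵥ x))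
    (hAs : As = (1 / 2 : ℝ) • (A + Aᵀ)) (hAa : Aa = (1 / 2 : ℝ) • (A - Aᵀ))
    (hAainv : IsUnit Aa)
    (hAt : At = As - Aa * As⁻¹ * Aa)
    (hAsh : As.IsHermitian) (hAth : At.IsHermitian) (hNh : (-(Aa * Aa)).IsHermitian) :
    -(Aa * Aa) = Aaᵀ * Aa ∧ (-(Aa * Aa)).PosDef ∧
      (⨅ i, hNh.eigenvalues i) / (⨆ i, hAsh.eigenvalues i) ≤ ⨅ i, hAth.eigenvalues i := by
  have : Nonempty (Fin n) := ⟨⟨0, hn⟩⟩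
  have hAat : Aaᵀ = -Aa := by
    rw [hAa, Matrix.transpose_smul, Matrix.transpose_sub, Matrix.transpose_transpose,
      ← smul_neg, neg_sub]
  have hN : -(Aa * Aa) = Aaᵀ * Aa := by rw [hAat, neg_mul]
  have hquad (B : Matrix (Fin n) (Fin n) ℝ) (x : Fin n → ℝ) :
      x ⬝ᵥ ((Aa * B * Aa) *ᵥ x) = -((Aa *ᵥ x) ⬝ᵥ (B *ᵥ (Aa *ᵥ x))) := by
    rw [← Matrix.mulVec_mulVec, ← Matrix.mulVec_mulVec, Matrix.dotProduct_mulVec,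
      ← Matrix.mulVec_transpose, hAat, Matrix.neg_mulVec, neg_dotProduct]
  have hNx (x : Fin n → ℝ) : x ⬝ᵥ (-(Aa * Aa) *ᵥ x) = (Aa *ᵥ x) ⬝ᵥ (Aa *ᵥ x) := by
    simpa [Matrix.neg_mulVec, neg_eq_iff_eq_neg] using hquad 1 x
  have hAsx (x : Fin n → ℝ) : x ⬝ᵥ (As *ᵥ x) = x ⬝ᵥ (A *ᵥ x) := by
    have hT : x ⬝ᵥ (Aᵀ *ᵥ x) = x ⬝ᵥ (A *ᵥ x) := by
      rw [Matrix.mulVec_transpose, dotProduct_comm, ← Matrix.dotProduct_mulVec]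
    rw [hAs, Matrix.smul_mulVec, Matrix.add_mulVec, dotProduct_smul, dotProduct_add, hT,
      smul_eq_mul]
    ring
  have hAspos : As.PosDef := .of_dotProduct_mulVec_pos hAsh fun x hx => by
    simpa [hAsx] using hA x hx
  refine ⟨hN, .of_dotProduct_mulVec_pos hNh fun x hx => ?_, hAth.le_iInf_eigenvalues fun x => ?_⟩
  · have hne : Aa *ᵥ x ≠ 0 := fun h0 =>
      hx (Matrix.mulVec_injective_of_isUnit hAainv (h0.trans (Matrix.mulVec_zero _).symm))
    rw [star_trivial, hNx]
    simpa using Matrix.dotProduct_star_self_pos_iff.2 hne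
  · calc (⨅ i, hNh.eigenvalues i) / (⨆ i, hAsh.eigenvalues i) * (x ⬝ᵥ x)
        = (⨅ i, hNh.eigenvalues i) * (x ⬝ᵥ x) / (⨆ i, hAsh.eigenvalues i) := by ring
      _ ≤ (Aa *ᵥ x) ⬝ᵥ (Aa *ᵥ x) / (⨆ i, hAsh.eigenvalues i) := by
        have hL : 0 < ⨆ i, hAsh.eigenvalues i := hAspos.iSup_eigenvalues_pos
        rw [← hNx]
        gcongr
        exact hNh.iInf_eigenvalues_mul_le x
      _ ≤ (Aa *ᵥ x) ⬝ᵥ (As⁻¹ *ᵥ (Aa *ᵥ x)) := hAspos.dotProduct_div_le_inv _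
      _ ≤ x ⬝ᵥ (As *ᵥ x) + (Aa *ᵥ x) ⬝ᵥ (As⁻¹ *ᵥ (Aa *ᵥ x)) :=
        le_add_of_nonneg_left (by simpa using hAspos.posSemidef.dotProduct_mulVec_nonneg x)
      _ = x ⬝ᵥ (At *ᵥ x) := by
        rw [hAt, Matrix.sub_mulVec, dotProduct_sub, hquad, sub_neg_eq_add]
end

section
/- Let A be an n×n real matrix that is positive definite (xᵀAx > 0 for all x ≠ 0), with symmetric part A_s = (A + Aᵀ)/2 and an invertible anti-symmetric part A_a = (A − Aᵀ)/2, and set Ã = Aᵀ A_s⁻¹ A = A_s − A_a A_s⁻¹ A_a. Then the condition number of Ã satisfies κ(Ã) ≤ κ(A_s)·κ(−A_a²) + λ_max(A_s)²/λ_min(−A_a²). -/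
open scoped Matrix

namespace Matrix.IsHermitian

variable {n : ℕ} {S : Matrix (Fin n) (Fin n) ℝ}

theorem sum_sq_dotProduct_eigenvectorBasis (hS : S.IsHermitian) (x : Fin n → ℝ) :
    ∑ i, ((hS.eigenvectorBasis i).ofLp ⬝ᵥ x) ^ 2 = x ⬝ᵥ x := by
  have h := hS.eigenvectorBasis.sum_inner_mul_inner (WithLp.toLp 2 x) (WithLp.toLp 2 x)
  simp only [EuclideanSpace.inner_eq_star_dotProduct, star_trivial] at h
  rw [← h]
  exact Finset.sum_congr rfl fun i _ => by rw [dotProduct_comm x, sq]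

theorem sum_eigenvalues_mul_sq_dotProduct_eigenvectorBasis (hS : S.IsHermitian)
    (x : Fin n → ℝ) :
    ∑ i, hS.eigenvalues i * ((hS.eigenvectorBasis i).ofLp ⬝ᵥ x) ^ 2 = x ⬝ᵥ (S *ᵥ x) := by
  have h := hS.eigenvectorBasis.sum_inner_mul_inner (WithLp.toLp 2 x) (WithLp.toLp 2 (S *ᵥ x))
  simp only [EuclideanSpace.inner_eq_star_dotProduct, star_trivial] at h
  rw [dotProduct_comm x, ← h]
  refine Finset.sum_congr rfl fun i _ => ?_
  have hT : Sᵀ = S := by simpa [conjTranspose_eq_transpose_of_trivial] using hS.eq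
  have h2 : (S *ᵥ x) ⬝ᵥ (hS.eigenvectorBasis i).ofLp
      = hS.eigenvalues i * ((hS.eigenvectorBasis i).ofLp ⬝ᵥ x) := by
    rw [dotProduct_comm, dotProduct_mulVec, ← mulVec_transpose, hT, hS.mulVec_eigenvectorBasis,
      smul_dotProduct, smul_eq_mul]
  rw [h2]
  ring

theorem iInf_eigenvalues_mul_le_s13 (hS : S.IsHermitian) (x : Fin n → ℝ) :
    (⨅ i, hS.eigenvalues i) * (x ⬝ᵥ x) ≤ x ⬝ᵥ (S *ᵥ x) := by
  rw [← hS.sum_sq_dotProduct_eigenvectorBasis,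
    ← hS.sum_eigenvalues_mul_sq_dotProduct_eigenvectorBasis, Finset.mul_sum]
  gcongr with i
  exact ciInf_le (Set.finite_range _).bddBelow i

theorem le_iSup_eigenvalues_mul_s13 (hS : S.IsHermitian) (x : Fin n → ℝ) :
    x ⬝ᵥ (S *ᵥ x) ≤ (⨆ i, hS.eigenvalues i) * (x ⬝ᵥ x) := by
  rw [← hS.sum_sq_dotProduct_eigenvectorBasis,
    ← hS.sum_eigenvalues_mul_sq_dotProduct_eigenvectorBasis, Finset.mul_sum]
  gcongr with i
  exact le_ciSup (Set.finite_range _).bddAbove i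

theorem exists_dotProduct_mulVec_eq_eigenvalues (hS : S.IsHermitian) (i : Fin n) :
    ∃ v : Fin n → ℝ, v ⬝ᵥ v = 1 ∧ v ⬝ᵥ (S *ᵥ v) = hS.eigenvalues i := by
  have h1 : (hS.eigenvectorBasis i).ofLp ⬝ᵥ (hS.eigenvectorBasis i).ofLp = 1 := by
    have h := hS.eigenvectorBasis.inner_eq_one i
    simpa only [EuclideanSpace.inner_eq_star_dotProduct, star_trivial] using h
  refine ⟨_, h1, ?_⟩
  rw [hS.mulVec_eigenvectorBasis, dotProduct_smul, h1, smul_eq_mul, mul_one]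

theorem iSup_eigenvalues_le [NeZero n] (hS : S.IsHermitian) {c : ℝ}
    (h : ∀ x : Fin n → ℝ, x ⬝ᵥ (S *ᵥ x) ≤ c * (x ⬝ᵥ x)) : ⨆ i, hS.eigenvalues i ≤ c := by
  refine ciSup_le fun i => ?_
  obtain ⟨v, hv, hvi⟩ := hS.exists_dotProduct_mulVec_eq_eigenvalues i
  simpa [hv, hvi] using h v

theorem le_iInf_eigenvalues_s13 [NeZero n] (hS : S.IsHermitian) {c : ℝ}
    (h : ∀ x : Fin n → ℝ, c * (x ⬝ᵥ x) ≤ x ⬝ᵥ (S *ᵥ x)) : c ≤ ⨅ i, hS.eigenvalues i := by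
  refine le_ciInf fun i => ?_
  obtain ⟨v, hv, hvi⟩ := hS.exists_dotProduct_mulVec_eq_eigenvalues i
  simpa [hv, hvi] using h v

theorem iInf_eigenvalues_pos [NeZero n] (hS : S.IsHermitian)
    (h : ∀ x : Fin n → ℝ, x ≠ 0 → 0 < x ⬝ᵥ (S *ᵥ x)) : 0 < ⨅ i, hS.eigenvalues i := by
  obtain ⟨i, hi⟩ := exists_eq_ciInf_of_finite (f := hS.eigenvalues)
  obtain ⟨v, hv, hvi⟩ := hS.exists_dotProduct_mulVec_eq_eigenvalues i
  rw [← hi, ← hvi]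
  refine h v ?_
  rintro rfl
  simp at hv

end Matrix.IsHermitian

namespace Matrix

variable {n : ℕ} {S : Matrix (Fin n) (Fin n) ℝ}

/-- A lower bound on the quadratic form of `S` gives an upper bound on that of `S⁻¹`. -/
theorem dotProduct_inv_mulVec_le (hdet : IsUnit S.det) {a : ℝ} (ha : 0 < a)
    (h : ∀ x : Fin n → ℝ, a * (x ⬝ᵥ x) ≤ x ⬝ᵥ (S *ᵥ x)) (y : Fin n → ℝ) :
    y ⬝ᵥ (S⁻¹ *ᵥ y) ≤ y ⬝ᵥ y / a := by
  obtain ⟨z, rfl⟩ : ∃ z, y = S *ᵥ z :=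
    ⟨S⁻¹ *ᵥ y, by rw [mulVec_mulVec, mul_nonsing_inv _ hdet, one_mulVec]⟩
  rw [mulVec_mulVec, nonsing_inv_mul _ hdet, one_mulVec, le_div_iff₀ ha]
  have h1 := h z
  have h2 : 0 ≤ (a • z - S *ᵥ z) ⬝ᵥ (a • z - S *ᵥ z) := by
    simpa using dotProduct_star_self_nonneg (a • z - S *ᵥ z)
  simp only [sub_dotProduct, dotProduct_sub, smul_dotProduct, dotProduct_smul, smul_eq_mul] at h2
  rw [dotProduct_comm (S *ᵥ z) z] at *
  nlinarith [mul_le_mul_of_nonneg_left h1 ha.le]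

/-- An upper bound on the quadratic form of a positive semidefinite symmetric `S` gives a lower
bound on that of `S⁻¹`. -/
theorem le_dotProduct_inv_mulVec (hT : Sᵀ = S) (hdet : IsUnit S.det) {b : ℝ} (hb : 0 < b)
    (h0 : ∀ x : Fin n → ℝ, 0 ≤ x ⬝ᵥ (S *ᵥ x))
    (h : ∀ x : Fin n → ℝ, x ⬝ᵥ (S *ᵥ x) ≤ b * (x ⬝ᵥ x)) (y : Fin n → ℝ) :
    y ⬝ᵥ y / b ≤ y ⬝ᵥ (S⁻¹ *ᵥ y) := by
  obtain ⟨z, rfl⟩ : ∃ z, y = S *ᵥ z :=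
    ⟨S⁻¹ *ᵥ y, by rw [mulVec_mulVec, mul_nonsing_inv _ hdet, one_mulVec]⟩
  rw [mulVec_mulVec, nonsing_inv_mul _ hdet, one_mulVec, div_le_iff₀ hb]
  have h1 := h (S *ᵥ z)
  have h2 := h0 (b • z - S *ᵥ z)
  have h3 : z ⬝ᵥ (S *ᵥ (S *ᵥ z)) = (S *ᵥ z) ⬝ᵥ (S *ᵥ z) := by
    rw [dotProduct_mulVec, ← mulVec_transpose, hT]
  simp only [mulVec_sub, mulVec_smul, sub_dotProduct, dotProduct_sub, smul_dotProduct,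
    dotProduct_smul, smul_eq_mul, h3] at h2
  rw [dotProduct_comm (S *ᵥ z) z]
  refine le_of_mul_le_mul_left ?_ hb
  linarith

theorem sub_mul_inv_mul_add {P Q : Matrix (Fin n) (Fin n) ℝ} (hP : IsUnit P.det) :
    (P - Q) * P⁻¹ * (P + Q) = P - Q * P⁻¹ * Q := by
  rw [sub_mul, mul_nonsing_inv _ hP, sub_mul, one_mul, mul_add, Matrix.mul_assoc Q P⁻¹ P,
    nonsing_inv_mul _ hP, mul_one]
  abel

theorem dotProduct_neg_mul_mul_mulVec {Q : Matrix (Fin n) (Fin n) ℝ} (hQ : Qᵀ = -Q)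
    (B : Matrix (Fin n) (Fin n) ℝ) (x : Fin n → ℝ) :
    x ⬝ᵥ (-(Q * B * Q) *ᵥ x) = (Q *ᵥ x) ⬝ᵥ (B *ᵥ (Q *ᵥ x)) := by
  rw [← neg_mul, ← neg_mul, ← hQ, ← mulVec_mulVec, ← mulVec_mulVec, dotProduct_mulVec,
    vecMul_transpose]

end Matrix

open Matrix in
/-- Condition number estimate `κ(Ã) ≤ κ(As)·κ(−Aa²) + λ_max(As)² / λ_min(−Aa²)` for
`Ã = Aᵀ As⁻¹ A = As − Aa As⁻¹ Aa`, where `A` is positive definite with symmetric part `As`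
and invertible anti-symmetric part `Aa`, and `κ(S) = λ_max(S)/λ_min(S)`. -/
theorem cond_tildeA_le_kappa_two {n : ℕ} (hn : 0 < n)
    (A As Aa At : Matrix (Fin n) (Fin n) ℝ)
    (hA : ∀ x : Fin n → ℝ, x ≠ 0 → 0 < x ⬝ᵥ (A *ᵥ x))
    (hAs : As = (1 / 2 : ℝ) • (A + Aᵀ)) (hAa : Aa = (1 / 2 : ℝ) • (A - Aᵀ))
    (hAainv : IsUnit Aa)
    (hAt : At = Aᵀ * As⁻¹ * A)
    (hAsh : As.IsHermitian) (hAth : At.IsHermitian) (hNh : (-(Aa * Aa)).IsHermitian) :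
    At = As - Aa * As⁻¹ * Aa ∧
      (⨆ i, hAth.eigenvalues i) / (⨅ i, hAth.eigenvalues i) ≤
        ((⨆ i, hAsh.eigenvalues i) / (⨅ i, hAsh.eigenvalues i))
            * ((⨆ i, hNh.eigenvalues i) / (⨅ i, hNh.eigenvalues i))
          + (⨆ i, hAsh.eigenvalues i) ^ 2 / (⨅ i, hNh.eigenvalues i) := by
  have : NeZero n := ⟨hn.ne'⟩
  have hA_eq : A = As + Aa := by rw [hAs, hAa]; module
  have hAT_eq : Aᵀ = As - Aa := by rw [hAs, hAa]; module
  have hsT : Asᵀ = As := by simpa [conjTranspose_eq_transpose_of_trivial] using hAsh.eq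
  have haT : Aaᵀ = -Aa := by
    rw [hAa, transpose_smul, transpose_sub, transpose_transpose]; module
  have hs_pos : ∀ x : Fin n → ℝ, x ≠ 0 → 0 < x ⬝ᵥ (As *ᵥ x) := by
    intro x hx
    have h1 := hA x hx
    have h2 : x ⬝ᵥ (Aᵀ *ᵥ x) = x ⬝ᵥ (A *ᵥ x) := by
      rw [mulVec_transpose, dotProduct_comm, dotProduct_mulVec]
    rw [hAs, smul_mulVec, add_mulVec, dotProduct_smul, dotProduct_add, h2, smul_eq_mul]
    linarith
  have hs_nonneg : ∀ x : Fin n → ℝ, 0 ≤ x ⬝ᵥ (As *ᵥ x) := by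
    intro x
    rcases eq_or_ne x 0 with rfl | hx
    · simp
    · exact (hs_pos x hx).le
  have hdet : IsUnit As.det := by
    rw [← isUnit_iff_isUnit_det, ← mulVec_injective_iff_isUnit,
      ← coe_mulVecLin, injective_iff_map_eq_zero]
    intro x hx
    by_contra hne
    have := hs_pos x hne
    rw [mulVecLin_apply] at hx
    simp [hx] at this
  have ht : At = As - Aa * As⁻¹ * Aa := by
    rw [hAt, hAT_eq, hA_eq, sub_mul_inv_mul_add hdet]
  refine ⟨ht, ?_⟩
  have hN_form : ∀ x : Fin n → ℝ, x ⬝ᵥ (-(Aa * Aa) *ᵥ x) = (Aa *ᵥ x) ⬝ᵥ (Aa *ᵥ x) := by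
    intro x
    simpa using dotProduct_neg_mul_mul_mulVec haT 1 x
  have ht_form : ∀ x : Fin n → ℝ, x ⬝ᵥ (At *ᵥ x)
      = x ⬝ᵥ (As *ᵥ x) + (Aa *ᵥ x) ⬝ᵥ (As⁻¹ *ᵥ (Aa *ᵥ x)) := by
    intro x
    rw [ht, sub_eq_add_neg, add_mulVec, dotProduct_add, dotProduct_neg_mul_mul_mulVec haT]
  have hN_pos : ∀ x : Fin n → ℝ, x ≠ 0 → 0 < x ⬝ᵥ (-(Aa * Aa) *ᵥ x) := by
    intro x hx
    rw [hN_form]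
    have hne : Aa *ᵥ x ≠ 0 := fun h0 =>
      hx (mulVec_injective_iff_isUnit.mpr hAainv (by rw [h0, mulVec_zero]))
    simpa using dotProduct_star_self_pos_iff.mpr hne
  have ha := hAsh.iInf_eigenvalues_pos hs_pos
  have hm := hNh.iInf_eigenvalues_pos hN_pos
  have hs_lower := hAsh.iInf_eigenvalues_mul_le_s13
  have hs_upper := hAsh.le_iSup_eigenvalues_mul_s13
  have hN_lower := hNh.iInf_eigenvalues_mul_le_s13
  have hN_upper := hNh.le_iSup_eigenvalues_mul_s13
  have hab : (⨅ i, hAsh.eigenvalues i) ≤ ⨆ i, hAsh.eigenvalues i :=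
    ciInf_le_ciSup (Set.finite_range _).bddBelow (Set.finite_range _).bddAbove
  have hmM : (⨅ i, hNh.eigenvalues i) ≤ ⨆ i, hNh.eigenvalues i :=
    ciInf_le_ciSup (Set.finite_range _).bddBelow (Set.finite_range _).bddAbove
  generalize (⨅ i, hAsh.eigenvalues i) = a at *
  generalize (⨆ i, hAsh.eigenvalues i) = b at *
  generalize (⨅ i, hNh.eigenvalues i) = m at *
  generalize (⨆ i, hNh.eigenvalues i) = M at *
  have hb : 0 < b := ha.trans_le hab
  have hM : 0 < M := hm.trans_le hmM
  have ht_upper : ⨆ i, hAth.eigenvalues i ≤ b + M / a := by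
    refine hAth.iSup_eigenvalues_le fun x => ?_
    have h1 := dotProduct_inv_mulVec_le hdet ha hs_lower (Aa *ᵥ x)
    have h2 := div_le_div_of_nonneg_right (hN_upper x) ha.le
    rw [hN_form] at h2
    rw [ht_form, add_mul, div_mul_eq_mul_div]
    linarith [hs_upper x]
  have ht_lower : m / b ≤ ⨅ i, hAth.eigenvalues i := by
    refine hAth.le_iInf_eigenvalues_s13 fun x => ?_
    have h1 := le_dotProduct_inv_mulVec hsT hdet hb hs_nonneg hs_upper (Aa *ᵥ x)
    have h2 := div_le_div_of_nonneg_right (hN_lower x) hb.le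
    rw [hN_form] at h2
    rw [ht_form, div_mul_eq_mul_div]
    linarith [hs_nonneg x]
  calc (⨆ i, hAth.eigenvalues i) / (⨅ i, hAth.eigenvalues i)
      ≤ (b + M / a) / (m / b) := by gcongr
    _ = b / a * (M / m) + b ^ 2 / m := by field_simp; ring
end

section
/- Let A_s be a symmetric positive definite n×n real matrix, let J be an anti-symmetric n×n real matrix with J² = −I, let ε > 0, and set A_ε = A_s + (1/ε)J and Ã_ε = A_εᵀ A_s⁻¹ A_ε. Then the condition number of the symmetric positive definite matrix Ã_ε satisfies κ(Ã_ε) ≤ κ(A_s) + ε² λ_max(A_s)². -/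
open scoped Matrix

/-- In an orthonormal eigenbasis a symmetric quadratic form is a weighted sum of squares. -/
theorem Matrix.IsHermitian.exists_dotProduct_mulVec_eq_sum_s14 {n : ℕ}
    {A : Matrix (Fin n) (Fin n) ℝ} (hA : A.IsHermitian) (x : Fin n → ℝ) :
    ∃ y : Fin n → ℝ, x ⬝ᵥ x = ∑ i, y i ^ 2 ∧
      x ⬝ᵥ A *ᵥ x = ∑ i, hA.eigenvalues i * y i ^ 2 := by
  set U : Matrix (Fin n) (Fin n) ℝ := hA.eigenvectorUnitary.1
  have hUU : U * Uᵀ = 1 := by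
    have := Unitary.coe_mul_star_self hA.eigenvectorUnitary
    rwa [Unitary.coe_star, Matrix.star_eq_conjTranspose,
      Matrix.conjTranspose_eq_transpose_of_trivial] at this
  have hsp : A = U * Matrix.diagonal hA.eigenvalues * Uᵀ := by
    have := hA.spectral_theorem
    rw [Unitary.conjStarAlgAut_apply, Matrix.star_eq_conjTranspose,
      Matrix.conjTranspose_eq_transpose_of_trivial] at this
    exact this
  refine ⟨Uᵀ *ᵥ x, ?_, ?_⟩
  · have : x ⬝ᵥ x = (Uᵀ *ᵥ x) ⬝ᵥ (Uᵀ *ᵥ x) := by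
      rw [Matrix.dotProduct_mulVec, Matrix.vecMul_transpose, Matrix.mulVec_mulVec, hUU,
        Matrix.one_mulVec]
    rw [this]
    simp only [dotProduct, sq]
  · have : x ⬝ᵥ A *ᵥ x = (Uᵀ *ᵥ x) ⬝ᵥ (Matrix.diagonal hA.eigenvalues *ᵥ (Uᵀ *ᵥ x)) := by
      conv_lhs => rw [hsp]
      rw [← Matrix.mulVec_mulVec, ← Matrix.mulVec_mulVec, Matrix.dotProduct_mulVec,
        ← Matrix.mulVec_transpose]
    rw [this]
    simp only [dotProduct, Matrix.mulVec_diagonal]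
    exact Finset.sum_congr rfl fun i _ => by ring

theorem Matrix.IsHermitian.dotProduct_mulVec_le_iSup {n : ℕ}
    {A : Matrix (Fin n) (Fin n) ℝ} (hA : A.IsHermitian) (x : Fin n → ℝ) :
    x ⬝ᵥ A *ᵥ x ≤ (⨆ i, hA.eigenvalues i) * (x ⬝ᵥ x) := by
  obtain ⟨y, h1, h2⟩ := hA.exists_dotProduct_mulVec_eq_sum_s14 x
  rw [h1, h2, Finset.mul_sum]
  exact Finset.sum_le_sum fun i _ => mul_le_mul_of_nonneg_right
    (le_ciSup (Set.finite_range _).bddAbove i) (sq_nonneg _)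

theorem Matrix.IsHermitian.iInf_le_dotProduct_mulVec {n : ℕ}
    {A : Matrix (Fin n) (Fin n) ℝ} (hA : A.IsHermitian) (x : Fin n → ℝ) :
    (⨅ i, hA.eigenvalues i) * (x ⬝ᵥ x) ≤ x ⬝ᵥ A *ᵥ x := by
  obtain ⟨y, h1, h2⟩ := hA.exists_dotProduct_mulVec_eq_sum_s14 x
  rw [h1, h2, Finset.mul_sum]
  exact Finset.sum_le_sum fun i _ => mul_le_mul_of_nonneg_right
    (ciInf_le (Set.finite_range _).bddBelow i) (sq_nonneg _)

/-- Each eigenvalue is the value of the quadratic form at some unit vector. -/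
theorem Matrix.IsHermitian.exists_dotProduct_mulVec_eq_eigenvalues_s14 {n : ℕ}
    {A : Matrix (Fin n) (Fin n) ℝ} (hA : A.IsHermitian) (i : Fin n) :
    ∃ v : Fin n → ℝ, v ⬝ᵥ v = 1 ∧ v ⬝ᵥ A *ᵥ v = hA.eigenvalues i := by
  have h1 : (hA.eigenvectorBasis i).ofLp ⬝ᵥ (hA.eigenvectorBasis i).ofLp = 1 := by
    have := hA.eigenvectorBasis.orthonormal.1 i
    have h := real_inner_self_eq_norm_sq (hA.eigenvectorBasis i)
    rw [this, EuclideanSpace.inner_eq_star_dotProduct] at h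
    simpa using h
  refine ⟨_, h1, ?_⟩
  rw [hA.mulVec_eigenvectorBasis, dotProduct_smul, h1, smul_eq_mul, mul_one]

theorem Matrix.PosDef.iInf_eigenvalues_pos {n : ℕ} [Nonempty (Fin n)]
    {A : Matrix (Fin n) (Fin n) ℝ} (hA : A.PosDef) : 0 < ⨅ i, hA.1.eigenvalues i := by
  obtain ⟨i, hi⟩ := exists_eq_ciInf_of_finite (f := hA.1.eigenvalues)
  rw [← hi]
  exact hA.eigenvalues_pos i

theorem Matrix.PosDef.iSup_eigenvalues_pos_s14 {n : ℕ} [Nonempty (Fin n)]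
    {A : Matrix (Fin n) (Fin n) ℝ} (hA : A.PosDef) : 0 < ⨆ i, hA.1.eigenvalues i :=
  hA.iInf_eigenvalues_pos.trans_le
    (ciInf_le_ciSup (Set.finite_range _).bddBelow (Set.finite_range _).bddAbove)

theorem Matrix.PosDef.mulVec_inv_mulVec {n : ℕ}
    {A : Matrix (Fin n) (Fin n) ℝ} (hA : A.PosDef) (y : Fin n → ℝ) : A *ᵥ (A⁻¹ *ᵥ y) = y := by
  rw [Matrix.mulVec_mulVec,
    Matrix.mul_nonsing_inv _ ((Matrix.isUnit_iff_isUnit_det _).1 hA.isUnit), Matrix.one_mulVec]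

theorem Matrix.PosDef.iInf_mul_dotProduct_inv_mulVec_le {n : ℕ} [Nonempty (Fin n)]
    {A : Matrix (Fin n) (Fin n) ℝ} (hA : A.PosDef) (y : Fin n → ℝ) :
    (⨅ i, hA.1.eigenvalues i) * (y ⬝ᵥ A⁻¹ *ᵥ y) ≤ y ⬝ᵥ y := by
  have hm := hA.iInf_eigenvalues_pos
  set m := ⨅ i, hA.1.eigenvalues i
  set z := A⁻¹ *ᵥ y
  have hz : A *ᵥ z = y := hA.mulVec_inv_mulVec y
  have h1 : m * (z ⬝ᵥ z) ≤ z ⬝ᵥ A *ᵥ z := hA.1.iInf_le_dotProduct_mulVec z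
  have h2 : 0 ≤ (y - m • z) ⬝ᵥ (y - m • z) := dotProduct_self_star_nonneg (y - m • z)
  rw [hz, dotProduct_comm z y] at h1
  simp only [sub_dotProduct, dotProduct_sub, smul_dotProduct, dotProduct_smul, smul_eq_mul,
    dotProduct_comm z y] at h2
  nlinarith [mul_le_mul_of_nonneg_left h1 hm.le]

theorem Matrix.PosDef.le_iSup_mul_dotProduct_inv_mulVec {n : ℕ} [Nonempty (Fin n)]
    {A : Matrix (Fin n) (Fin n) ℝ} (hA : A.PosDef) (y : Fin n → ℝ) :
    y ⬝ᵥ y ≤ (⨆ i, hA.1.eigenvalues i) * (y ⬝ᵥ A⁻¹ *ᵥ y) := by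
  have hM : 0 < ⨆ i, hA.1.eigenvalues i := hA.iSup_eigenvalues_pos_s14
  have h1 := hA.1.dotProduct_mulVec_le_iSup y
  set M := ⨆ i, hA.1.eigenvalues i
  set z := A⁻¹ *ᵥ y
  have hz : A *ᵥ z = y := hA.mulVec_inv_mulVec y
  have hzy : z ⬝ᵥ A *ᵥ y = y ⬝ᵥ y := by
    have hT : Aᵀ = A := by simpa using hA.1.eq
    rw [Matrix.dotProduct_mulVec, ← Matrix.mulVec_transpose, hT, hz]
  have h2 : 0 ≤ (y - M • z) ⬝ᵥ A *ᵥ (y - M • z) := by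
    simpa using hA.posSemidef.dotProduct_mulVec_nonneg (y - M • z)
  simp only [Matrix.mulVec_sub, Matrix.mulVec_smul, sub_dotProduct, dotProduct_sub,
    smul_dotProduct, dotProduct_smul, smul_eq_mul, hz, hzy, dotProduct_comm z y] at h2
  have h3 : M * (y ⬝ᵥ y) ≤ M * (M * (y ⬝ᵥ z)) := by linarith
  exact le_of_mul_le_mul_left h3 hM


open scoped Matrix

/-- Let `As` be symmetric positive definite, `J` anti-symmetric with `J² = −I`, `ε > 0`,
`A_ε = As + (1/ε) J` and `Ã_ε = A_εᵀ As⁻¹ A_ε`. Then `Ã_ε` is symmetric positive definite and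
`κ(Ã_ε) ≤ κ(As) + ε² λ_max(As)²`. -/
theorem cond_symplectic_perturbation {n : ℕ} (hn : 0 < n)
    (As J : Matrix (Fin n) (Fin n) ℝ)
    (hAs : As.PosDef) (hJ : Jᵀ = -J) (hJ2 : J * J = -1)
    (ε : ℝ) (hε : 0 < ε)
    (Aε Atε : Matrix (Fin n) (Fin n) ℝ)
    (hAε : Aε = As + ε⁻¹ • J) (hAtε : Atε = Aεᵀ * As⁻¹ * Aε)
    (hAth : Atε.IsHermitian) :
    Atε.PosDef ∧
      (⨆ i, hAth.eigenvalues i) / (⨅ i, hAth.eigenvalues i) ≤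
        (⨆ i, hAs.1.eigenvalues i) / (⨅ i, hAs.1.eigenvalues i)
          + ε ^ 2 * (⨆ i, hAs.1.eigenvalues i) ^ 2 := by
  have : Nonempty (Fin n) := ⟨⟨0, hn⟩⟩
  have hm := hAs.iInf_eigenvalues_pos
  have hM : 0 < ⨆ i, hAs.1.eigenvalues i := hAs.iSup_eigenvalues_pos_s14
  have hdet : IsUnit As.det := (Matrix.isUnit_iff_isUnit_det _).1 hAs.isUnit
  have hT : Asᵀ = As := by simpa using hAs.1.eq
  have hform : ∀ x : Fin n → ℝ, x ⬝ᵥ Atε *ᵥ x =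
      x ⬝ᵥ As *ᵥ x + (ε⁻¹) ^ 2 * ((J *ᵥ x) ⬝ᵥ As⁻¹ *ᵥ (J *ᵥ x)) := by
    intro x
    have h : Atε = As + (ε⁻¹) ^ 2 • (Jᵀ * As⁻¹ * J) := by
      rw [hAtε, hAε, Matrix.transpose_add, Matrix.transpose_smul, hT, hJ]
      simp only [Matrix.add_mul, Matrix.mul_add, Matrix.smul_mul, Matrix.mul_smul,
        Matrix.mul_nonsing_inv _ hdet, Matrix.one_mul, Matrix.neg_mul, smul_neg,
        Matrix.mul_assoc, Matrix.nonsing_inv_mul _ hdet, Matrix.mul_one, sq, mul_smul,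
        smul_add]
      abel
    rw [h, Matrix.add_mulVec, dotProduct_add, Matrix.smul_mulVec, dotProduct_smul, smul_eq_mul,
      ← Matrix.mulVec_mulVec, ← Matrix.mulVec_mulVec, Matrix.dotProduct_mulVec x Jᵀ,
      Matrix.vecMul_transpose]
  have hnorm : ∀ x : Fin n → ℝ, (J *ᵥ x) ⬝ᵥ (J *ᵥ x) = x ⬝ᵥ x := by
    intro x
    rw [Matrix.dotProduct_mulVec, ← Matrix.mulVec_transpose, hJ, Matrix.mulVec_mulVec,
      Matrix.neg_mul, hJ2, neg_neg, Matrix.one_mulVec]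
  have hupper : ∀ x : Fin n → ℝ, x ⬝ᵥ Atε *ᵥ x ≤
      ((⨆ i, hAs.1.eigenvalues i) + (ε⁻¹) ^ 2 / (⨅ i, hAs.1.eigenvalues i)) * (x ⬝ᵥ x) := by
    intro x
    have h := hAs.iInf_mul_dotProduct_inv_mulVec_le (J *ᵥ x)
    rw [hnorm, ← le_div_iff₀' hm] at h
    calc _ ≤ _ := (hform x).le.trans (add_le_add (hAs.1.dotProduct_mulVec_le_iSup x)
          (mul_le_mul_of_nonneg_left h (sq_nonneg _)))
      _ = _ := by ring
  have hlower : ∀ x : Fin n → ℝ,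
      ((⨅ i, hAs.1.eigenvalues i) + (ε⁻¹) ^ 2 / (⨆ i, hAs.1.eigenvalues i)) * (x ⬝ᵥ x) ≤
        x ⬝ᵥ Atε *ᵥ x := by
    intro x
    have h := hAs.le_iSup_mul_dotProduct_inv_mulVec (J *ᵥ x)
    rw [hnorm, ← div_le_iff₀' hM] at h
    calc _ = _ := by ring
      _ ≤ _ := (add_le_add (hAs.1.iInf_le_dotProduct_mulVec x)
          (mul_le_mul_of_nonneg_left h (sq_nonneg (ε⁻¹)))).trans (hform x).ge
  have hsup : (⨆ i, hAth.eigenvalues i) ≤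
      (⨆ i, hAs.1.eigenvalues i) + (ε⁻¹) ^ 2 / (⨅ i, hAs.1.eigenvalues i) := by
    refine ciSup_le fun i => ?_
    obtain ⟨v, hv, hi⟩ := hAth.exists_dotProduct_mulVec_eq_eigenvalues_s14 i
    simpa [hv, hi] using hupper v
  have hinf : (⨅ i, hAs.1.eigenvalues i) + (ε⁻¹) ^ 2 / (⨆ i, hAs.1.eigenvalues i) ≤
      ⨅ i, hAth.eigenvalues i := by
    refine le_ciInf fun i => ?_
    obtain ⟨v, hv, hi⟩ := hAth.exists_dotProduct_mulVec_eq_eigenvalues_s14 i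
    simpa [hv, hi] using hlower v
  generalize (⨆ i, hAs.1.eigenvalues i) = M at *
  generalize (⨅ i, hAs.1.eigenvalues i) = m at *
  have hpos : 0 < m + (ε⁻¹) ^ 2 / M := by positivity
  refine ⟨hAth.posDef_iff_eigenvalues_pos.2 fun i => (hpos.trans_le hinf).trans_le
    (ciInf_le (Set.finite_range _).bddBelow i), ?_⟩
  rw [div_le_iff₀ (hpos.trans_le hinf)]
  calc _ ≤ M + (ε⁻¹) ^ 2 / m := hsup
    _ ≤ M + (ε⁻¹) ^ 2 / m + (M + ε ^ 2 * M ^ 2 * m) := le_add_of_nonneg_right (by positivity)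
    _ = (M / m + ε ^ 2 * M ^ 2) * (m + (ε⁻¹) ^ 2 / M) := by
      field_simp
      ring
    _ ≤ _ := mul_le_mul_of_nonneg_left hinf (by positivity)
end

section
/- Let A be an n×n real matrix whose symmetric part A_s = (A + Aᵀ)/2 is invertible, let A_a = (A − Aᵀ)/2, and set Ã = Aᵀ A_s⁻¹ A. Then the spectral radius of I − A_s⁻¹Ã equals the square of the spectral radius of A_s⁻¹A_a, i.e. ρ(I − A_s⁻¹Ã) = ρ((A_s⁻¹A_a)²) = ρ(A_s⁻¹A_a)²; in particular, if 0 < ρ(A_s⁻¹A_a) < 1 then ρ(I − A_s⁻¹Ã) < ρ(A_s⁻¹A_a). -/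
open scoped Matrix ENNReal

/-- Over an algebraically closed field, the spectral radius is multiplicative on powers. -/
theorem spectralRadius_pow_of_pos {𝕜 R : Type*} [NormedField 𝕜] [IsAlgClosed 𝕜] [Ring R]
    [Algebra 𝕜 R] (a : R) {n : ℕ} (hn : 0 < n) :
    spectralRadius 𝕜 (a ^ n) = spectralRadius 𝕜 a ^ n := by
  simp only [spectralRadius, spectrum.map_pow_of_pos a hn, iSup_image, nnnorm_pow,
    ENNReal.coe_pow, ENNReal.iSup₂_pow_of_ne_zero _ (Nat.ne_of_gt hn)]

/-- If `S` and `K` are the symmetric and anti-symmetric parts of `A`, then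
`1 - S⁻¹ (Aᵀ S⁻¹ A) = (S⁻¹ K) ^ 2`. -/
theorem Matrix.one_sub_inv_symmPart_mul_eq_sq {ι : Type*} [Fintype ι] [DecidableEq ι]
    {A S K : Matrix ι ι ℝ} (hS : S = (1 / 2 : ℝ) • (A + Aᵀ)) (hK : K = (1 / 2 : ℝ) • (A - Aᵀ))
    (hu : IsUnit S) : 1 - S⁻¹ * (Aᵀ * S⁻¹ * A) = (S⁻¹ * K) ^ 2 := by
  have hA : A = S + K := by rw [hS, hK]; module
  have hAT : Aᵀ = S - K := by rw [hS, hK]; module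
  have hinv : S⁻¹ * S = 1 := S.nonsing_inv_mul ((S.isUnit_iff_isUnit_det).mp hu)
  calc
    1 - S⁻¹ * (Aᵀ * S⁻¹ * A) = 1 - S⁻¹ * Aᵀ * (S⁻¹ * A) := by simp only [mul_assoc]
    _ = 1 - (1 - S⁻¹ * K) * (1 + S⁻¹ * K) := by
      rw [hAT, hA, mul_sub, mul_add, hinv]
    _ = (S⁻¹ * K) ^ 2 := by noncomm_ring

/-- Spectral radius identity: for `Ã = Aᵀ As⁻¹ A` (with `As` invertible symmetric part and `Aa`
anti-symmetric part of `A`), `ρ(I − As⁻¹ Ã) = ρ((As⁻¹ Aa)²) = ρ(As⁻¹ Aa)²`; in particular if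
`0 < ρ(As⁻¹ Aa) < 1` then `ρ(I − As⁻¹ Ã) < ρ(As⁻¹ Aa)`. Spectral radii are computed for the
complexifications, so that all complex eigenvalues are accounted for. -/
theorem spectral_radius_squared {n : ℕ} (A As Aa At : Matrix (Fin n) (Fin n) ℝ)
    (hAs : As = (1 / 2 : ℝ) • (A + Aᵀ)) (hAa : Aa = (1 / 2 : ℝ) • (A - Aᵀ))
    (hs : IsUnit As) (hAt : At = Aᵀ * As⁻¹ * A) :
    spectralRadius ℂ ((1 - As⁻¹ * At).map (algebraMap ℝ ℂ)) =
        spectralRadius ℂ (((As⁻¹ * Aa) ^ 2).map (algebraMap ℝ ℂ)) ∧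
      spectralRadius ℂ ((1 - As⁻¹ * At).map (algebraMap ℝ ℂ)) =
        (spectralRadius ℂ ((As⁻¹ * Aa).map (algebraMap ℝ ℂ))) ^ 2 ∧
      (0 < spectralRadius ℂ ((As⁻¹ * Aa).map (algebraMap ℝ ℂ)) →
        spectralRadius ℂ ((As⁻¹ * Aa).map (algebraMap ℝ ℂ)) < 1 →
        spectralRadius ℂ ((1 - As⁻¹ * At).map (algebraMap ℝ ℂ)) <
          spectralRadius ℂ ((As⁻¹ * Aa).map (algebraMap ℝ ℂ))) := by
  have hM := Matrix.one_sub_inv_symmPart_mul_eq_sq hAs hAa hs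
  have hsq : spectralRadius ℂ (((As⁻¹ * Aa) ^ 2).map (algebraMap ℝ ℂ)) =
      spectralRadius ℂ ((As⁻¹ * Aa).map (algebraMap ℝ ℂ)) ^ 2 := by
    rw [Matrix.map_pow, spectralRadius_pow_of_pos _ two_pos]
  rw [hAt, hM, hsq]
  refine ⟨rfl, rfl, fun hpos hlt => ?_⟩
  generalize spectralRadius ℂ ((As⁻¹ * Aa).map (algebraMap ℝ ℂ)) = r at hpos hlt ⊢
  lift r to NNReal using hlt.ne_top
  norm_cast at hpos hlt ⊢
  exact pow_lt_self_of_lt_one₀ hpos hlt one_lt_two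
end

section
/- For ε ∈ ℝ with ε ≠ 0 and ε ≠ 1, let A_ε be the 2×2 real matrix with rows (1, −1) and (1, −1+ε), let A_s = (A_ε + A_εᵀ)/2 and A_a = (A_ε − A_εᵀ)/2. Then A_s is invertible and A_s − A_a A_s⁻¹ A_a = Aᵀ_ε A_s⁻¹ A_ε is the diagonal matrix diag(ε/(ε−1), ε); consequently, for 0 < ε < 1 the ratio of the largest to the smallest absolute value of its eigenvalues equals 1/(1−ε), which tends to 1 as ε → 0⁺. -/
open scoped Matrix

/-- The `2 × 2` example `A_ε = [[1, −1], [1, −1+ε]]` (`ε ≠ 0`, `ε ≠ 1`): its symmetric part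
`As` is invertible, `As − Aa As⁻¹ Aa = A_εᵀ As⁻¹ A_ε = diag(ε/(ε−1), ε)`; for `0 < ε < 1` the
ratio of the largest to the smallest absolute value of the eigenvalues of this diagonal matrix
equals `1/(1−ε)`, which tends to `1` as `ε → 0⁺`. -/
theorem two_by_two_example (ε : ℝ) (hε0 : ε ≠ 0) (hε1 : ε ≠ 1)
    (Aε As Aa : Matrix (Fin 2) (Fin 2) ℝ)
    (hAε : Aε = !![1, -1; 1, -1 + ε])
    (hAs : As = (1 / 2 : ℝ) • (Aε + Aεᵀ)) (hAa : Aa = (1 / 2 : ℝ) • (Aε - Aεᵀ)) :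
    IsUnit As ∧
      As - Aa * As⁻¹ * Aa = Aεᵀ * As⁻¹ * Aε ∧
      As - Aa * As⁻¹ * Aa = Matrix.diagonal ![ε / (ε - 1), ε] ∧
      (0 < ε → ε < 1 →
        max |ε / (ε - 1)| |ε| / min |ε / (ε - 1)| |ε| = 1 / (1 - ε)) ∧
      Filter.Tendsto (fun e : ℝ => 1 / (1 - e)) (nhdsWithin 0 (Set.Ioi 0)) (nhds 1) := by
  have hd : ε - 1 ≠ 0 := sub_ne_zero.mpr hε1
  have hS : As = !![1, 0; 0, ε - 1] := by
    subst hAs hAε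
    ext i j; fin_cases i <;> fin_cases j <;> simp <;> ring
  have hK : Aa = !![0, -1; 1, 0] := by
    subst hAa hAε
    ext i j; fin_cases i <;> fin_cases j <;> simp <;> ring
  have hmul : As * !![1, 0; 0, (ε - 1)⁻¹] = 1 := by
    rw [hS, Matrix.one_fin_two]
    simp [hd]
  have hinv : As⁻¹ = !![1, 0; 0, (ε - 1)⁻¹] := Matrix.inv_eq_right_inv hmul
  have hL : As - Aa * As⁻¹ * Aa = Matrix.diagonal ![ε / (ε - 1), ε] := by
    rw [hinv, hK, hS]
    ext i j; fin_cases i <;> fin_cases j <;> simp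
    field_simp
    ring
  have hR : Aεᵀ * As⁻¹ * Aε = Matrix.diagonal ![ε / (ε - 1), ε] := by
    rw [hinv, hAε]
    ext i j; fin_cases i <;> fin_cases j <;> simp [Matrix.mul_apply, Fin.sum_univ_two] <;>
      field_simp <;> ring
  refine ⟨IsUnit.of_mul_eq_one _ hmul, hL.trans hR.symm, hL, fun h0 h1 => ?_, ?_⟩
  · have hp : 0 < 1 - ε := sub_pos.mpr h1
    have habs : |ε / (ε - 1)| = ε / (1 - ε) := by
      rw [abs_div, abs_of_pos h0, abs_sub_comm, abs_of_pos hp]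
    have hle : ε ≤ ε / (1 - ε) := le_div_self h0.le hp (by linarith)
    rw [habs, abs_of_pos h0, max_eq_left hle, min_eq_right hle]
    field_simp
  · have hc : ContinuousAt (fun e : ℝ => 1 / (1 - e)) 0 :=
      continuousAt_const.div (by fun_prop) (by norm_num)
    simpa using hc.tendsto.mono_left nhdsWithin_le_nhds
end
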